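/- Let G and H be finitely generated groups with trivial intersection in the free product G * H. Suppose for all p ≥ 1 that G and H each admit 1-Lipschitz coarse embeddings into ℓ^p spaces with lower bound function ρ' (a concave function with ρ'(n) → ∞). Then (using the tree-graded embedding theorem for the Cayley graph of G*H with pieces the cosets of G and H) for all p ≥ 1, α_p^*(G*H) = min{α_p^*(G), α_p^*(H)}, where α_p^* denotes the ℓ^p compression exponent. -/

import Mathlib

open scoped ENNReal

/-- The word length of `g` with respect to a (symmetrized) generating set `S`. -/
noncomputable def wordNorm {G : Type*} [Group G] (S : Set G) (g : G) : ℕ :=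
  sInf {n : ℕ | ∃ l : List G, (∀ x ∈ l, x ∈ S ∨ x⁻¹ ∈ S) ∧ l.length = n ∧ l.prod = g}

/-- The word metric associated to a generating set `S`. -/
noncomputable def wordDist {G : Type*} [Group G] (S : Set G) (g h : G) : ℝ :=
  (wordNorm S (g⁻¹ * h) : ℝ)

/-- The `ℓ^p` compression exponent of a space `X` with distance function `d`: the supremum
of all `α ∈ [0,1]` for which there is a map `φ : X → ℓ^p` and a constant `C > 0` with
`C⁻¹ d(x,y)^α - C ≤ ‖φ x - φ y‖_p ≤ C d(x,y) + C`. -/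
noncomputable def compExp (p : ℝ) {X : Type*} (d : X → X → ℝ) : ℝ :=
  sSup {α : ℝ | 0 ≤ α ∧ α ≤ 1 ∧
    ∃ (φ : X → lp (fun _ : ℕ => ℝ) (ENNReal.ofReal p)) (C : ℝ), 0 < C ∧
      ∀ x y : X, C⁻¹ * d x y ^ α - C ≤ ‖φ x - φ y‖ ∧ ‖φ x - φ y‖ ≤ C * d x y + C}

section WordNorm

variable {G K : Type*} [Group G] [Group K] {S : Set G} {T : Set K}

theorem exists_list_prod_eq (hS : Subgroup.closure S = ⊤) (g : G) :
    ∃ l : List G, (∀ x ∈ l, x ∈ S ∨ x⁻¹ ∈ S) ∧ l.length = wordNorm S g ∧ l.prod = g := by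
  have hne : {n : ℕ | ∃ l : List G, (∀ x ∈ l, x ∈ S ∨ x⁻¹ ∈ S) ∧ l.length = n ∧
      l.prod = g}.Nonempty := by
    have hg : g ∈ (Subgroup.closure S).toSubmonoid := by rw [hS]; trivial
    rw [Subgroup.closure_toSubmonoid] at hg
    obtain ⟨l, hl, rfl⟩ := Submonoid.exists_list_of_mem_closure hg
    exact ⟨_, l, hl, rfl, rfl⟩
  exact Nat.sInf_mem hne

theorem wordNorm_prod_le {l : List G} (hl : ∀ x ∈ l, x ∈ S ∨ x⁻¹ ∈ S) :
    wordNorm S l.prod ≤ l.length :=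
  Nat.sInf_le ⟨l, hl, rfl, rfl⟩

@[simp]
theorem wordNorm_one : wordNorm S (1 : G) = 0 :=
  Nat.le_zero.1 (wordNorm_prod_le (l := []) (by simp))

theorem wordNorm_le_one {x : G} (hx : x ∈ S ∨ x⁻¹ ∈ S) : wordNorm S x ≤ 1 := by
  simpa using wordNorm_prod_le (S := S) (l := [x]) (by simpa using hx)

theorem wordNorm_mul_le (hS : Subgroup.closure S = ⊤) (g h : G) :
    wordNorm S (g * h) ≤ wordNorm S g + wordNorm S h := by
  obtain ⟨l, hl, hlen, hg⟩ := exists_list_prod_eq hS g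
  obtain ⟨l', hl', hlen', hh⟩ := exists_list_prod_eq hS h
  have := wordNorm_prod_le (S := S) (l := l ++ l') (by
    intro x hx
    rcases List.mem_append.1 hx with hx | hx
    exacts [hl x hx, hl' x hx])
  rwa [List.prod_append, hg, hh, List.length_append, hlen, hlen'] at this

/-- The word norm dominates every subadditive function that is at most `1` on generators. -/
theorem le_wordNorm_of_subadditive (hS : Subgroup.closure S = ⊤) {N : G → ℕ} (h1 : N 1 = 0)
    (hmul : ∀ g h, N (g * h) ≤ N g + N h) (hN : ∀ x, x ∈ S ∨ x⁻¹ ∈ S → N x ≤ 1) (g : G) :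
    N g ≤ wordNorm S g := by
  obtain ⟨l, hl, hlen, rfl⟩ := exists_list_prod_eq hS g
  rw [← hlen]
  clear hlen
  induction l with
  | nil => simp [h1]
  | cons x l ih =>
    simp only [List.mem_cons, forall_eq_or_imp] at hl
    rw [List.prod_cons, List.length_cons]
    have := hmul x l.prod
    have := hN x hl.1
    have := ih hl.2
    omega

theorem wordNorm_inv (hS : Subgroup.closure S = ⊤) (g : G) :
    wordNorm S g⁻¹ = wordNorm S g := by
  have key : ∀ g, wordNorm S g⁻¹ ≤ wordNorm S g :=
    le_wordNorm_of_subadditive hS (by simp)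
      (fun g h => by
        rw [mul_inv_rev, add_comm]
        exact wordNorm_mul_le hS _ _)
      (fun x hx => wordNorm_le_one (by rw [inv_inv]; exact hx.symm))
  exact le_antisymm (key g) (by simpa using key g⁻¹)

theorem wordNorm_map_le (hS : Subgroup.closure S = ⊤) (hT : Subgroup.closure T = ⊤) (f : G →* K)
    (hf : ∀ s ∈ S, f s ∈ T ∨ f s = 1) (g : G) : wordNorm T (f g) ≤ wordNorm S g := by
  have hgen : ∀ s ∈ S, wordNorm T (f s) ≤ 1 := fun s hs => by
    rcases hf s hs with h | h
    · exact wordNorm_le_one (.inl h)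
    · simp [h]
  refine le_wordNorm_of_subadditive (N := fun g => wordNorm T (f g)) hS (by simp)
    (fun g h => by simpa using wordNorm_mul_le hT (f g) (f h)) (fun x hx => ?_) g
  rcases hx with hx | hx
  · exact hgen x hx
  · simpa [wordNorm_inv hT] using hgen _ hx

theorem wordDist_nonneg (x y : G) : 0 ≤ wordDist S x y := Nat.cast_nonneg _

end WordNorm

section LpEmbedding

variable {I : Type*} {p : ℝ}

/-- The element of `ℓ^p` with the given coordinates. -/
def Memℓp.toLp {q : ℝ≥0∞} {f : I → ℝ} (h : Memℓp f q) : lp (fun _ : I => ℝ) q := ⟨f, h⟩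

theorem memℓp_and_norm_rpow_le {f : I → ℝ} {B : ℝ} (hp : 1 ≤ p) (hB : 0 ≤ B)
    (hf : ∑' i, ENNReal.ofReal (|f i| ^ p) ≤ ENNReal.ofReal (B ^ p)) :
    ∃ h : Memℓp f (ENNReal.ofReal p), ‖h.toLp‖ ≤ B := by
  have : Fact (1 ≤ ENNReal.ofReal p) := ⟨by simpa using hp⟩
  have hp0 : 0 < p := by linarith
  have hpR : (ENNReal.ofReal p).toReal = p := ENNReal.toReal_ofReal hp0.le
  have hnn : ∀ i, 0 ≤ |f i| ^ p := fun i => by positivity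
  have hsum : Summable fun i => |f i| ^ p := by
    have := ENNReal.summable_toReal (ne_top_of_le_ne_top ENNReal.ofReal_ne_top hf)
    simpa [ENNReal.toReal_ofReal (hnn _)] using this
  have hmem : Memℓp f (ENNReal.ofReal p) := memℓp_gen (by simpa [hpR] using hsum)
  refine ⟨hmem, ?_⟩
  have hnorm := lp.norm_rpow_eq_tsum (by rw [hpR]; exact hp0)
    hmem.toLp
  rw [hpR] at hnorm
  rw [← Real.rpow_le_rpow_iff (norm_nonneg _) hB hp0, hnorm,
    ← ENNReal.ofReal_le_ofReal_iff (by positivity)]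
  refine le_trans (le_of_eq ?_) hf
  exact ENNReal.ofReal_tsum_of_nonneg hnn hsum

/-- Extension by zero along an injection is an isometry of `ℓ^p` spaces. -/
theorem exists_isometry_lp_nat (I : Type*) [Countable I] (hp : 1 ≤ p) :
    ∃ e : lp (fun _ : I => ℝ) (ENNReal.ofReal p) → lp (fun _ : ℕ => ℝ) (ENNReal.ofReal p),
      ∀ x y, ‖e x - e y‖ = ‖x - y‖ := by
  have : Fact (1 ≤ ENNReal.ofReal p) := ⟨by simpa using hp⟩
  have hp0 : 0 < p := by linarith
  have hpR : (ENNReal.ofReal p).toReal = p := ENNReal.toReal_ofReal hp0.le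
  obtain ⟨ν, hν⟩ := exists_injective_nat I
  have hcomp : ∀ (f : I → ℝ), (fun n => ‖Function.extend ν f 0 n‖ ^ p) =
      Function.extend ν (fun i => ‖f i‖ ^ p) 0 := fun f => by
    funext n
    by_cases hn : ∃ i, ν i = n
    · obtain ⟨i, rfl⟩ := hn
      simp [hν.extend_apply]
    · simp [Function.extend_apply' _ _ _ hn, hp0.ne']
  have hmem : ∀ f : lp (fun _ : I => ℝ) (ENNReal.ofReal p),
      Memℓp (Function.extend ν f 0) (ENNReal.ofReal p) := fun f => by
    refine memℓp_gen ?_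
    rw [hpR, hcomp]
    have := (lp.memℓp f).summable (by rw [hpR]; exact hp0)
    rw [hpR] at this
    exact (summable_extend_zero hν).2 this
  refine ⟨fun f => (hmem f).toLp, fun x y => ?_⟩
  rw [← Real.rpow_left_inj (norm_nonneg _) (norm_nonneg _) hp0.ne']
  have h1 := lp.norm_rpow_eq_tsum (p := ENNReal.ofReal p) (by rw [hpR]; exact hp0) (x - y)
  have h2 := lp.norm_rpow_eq_tsum (p := ENNReal.ofReal p) (by rw [hpR]; exact hp0)
    ((hmem x).toLp - (hmem y).toLp)
  rw [hpR] at h1 h2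
  rw [h1, h2]
  have hsub : ∀ n, ((hmem x).toLp - (hmem y).toLp) n =
      Function.extend ν (⇑(x - y)) 0 n := fun n => by
    change Function.extend ν x 0 n - Function.extend ν y 0 n = _
    by_cases hn : ∃ i, ν i = n
    · obtain ⟨i, rfl⟩ := hn
      rw [hν.extend_apply, hν.extend_apply, hν.extend_apply]
      rfl
    · rw [Function.extend_apply' _ _ _ hn, Function.extend_apply' _ _ _ hn,
        Function.extend_apply' _ _ _ hn]
      exact sub_self 0
  simp_rw [hsub]
  rw [hcomp]
  exact tsum_extend_zero hν _

theorem ofReal_norm_rpow_eq_tsum (hp : 1 ≤ p) (f : lp (fun _ : I => ℝ) (ENNReal.ofReal p)) :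
    ENNReal.ofReal (‖f‖ ^ p) = ∑' i, ENNReal.ofReal (|f i| ^ p) := by
  have hp0 : 0 < p := by linarith
  have hpR : (ENNReal.ofReal p).toReal = p := ENNReal.toReal_ofReal hp0.le
  have hnorm := lp.norm_rpow_eq_tsum (by rw [hpR]; exact hp0) f
  have hsum := (lp.memℓp f).summable (by rw [hpR]; exact hp0)
  rw [hpR] at hnorm hsum
  rw [hnorm, ENNReal.ofReal_tsum_of_nonneg (fun i => by positivity) hsum]
  simp only [Real.norm_eq_abs]

/-- A family of coordinates that varies by a bounded `ℓ^p` amount along each edge of a Cayley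
graph defines a Lipschitz map to `ℓ^p`. -/
theorem exists_lipschitz_lp {Γ : Type*} [Group Γ] {S : Set Γ} (hS : Subgroup.closure S = ⊤)
    [Countable I] (hp : 1 ≤ p) (g : Γ → I → ℝ) {B : ℝ} (hB : 0 ≤ B)
    (hg : ∀ a, ∀ x ∈ S,
      ∑' i, ENNReal.ofReal (|g (a * x) i - g a i| ^ p) ≤ ENNReal.ofReal (B ^ p)) :
    ∃ F : Γ → lp (fun _ : ℕ => ℝ) (ENNReal.ofReal p), ∀ a b,
      ‖F a - F b‖ ≤ B * wordDist S a b ∧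
      ENNReal.ofReal (‖F a - F b‖ ^ p) = ∑' i, ENNReal.ofReal (|g a i - g b i| ^ p) := by
  have : Fact (1 ≤ ENNReal.ofReal p) := ⟨by simpa using hp⟩
  have hstep : ∀ a x, (x ∈ S ∨ x⁻¹ ∈ S) →
      ∃ h : Memℓp (fun i => g (a * x) i - g a i) (ENNReal.ofReal p),
        ‖h.toLp‖ ≤ B := by
    rintro a x (hx | hx)
    · exact memℓp_and_norm_rpow_le hp hB (hg a x hx)
    · refine memℓp_and_norm_rpow_le hp hB ?_
      have := hg (a * x) x⁻¹ hx
      rw [mul_inv_cancel_right] at this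
      simpa only [abs_sub_comm] using this
  have hpath : ∀ a b, ∃ h : Memℓp (fun i => g b i - g a i) (ENNReal.ofReal p),
      ‖h.toLp‖ ≤ B * wordNorm S (a⁻¹ * b) := by
    intro a b
    obtain ⟨l, hl, hlen, hprod⟩ := exists_list_prod_eq hS (a⁻¹ * b)
    obtain rfl : b = a * l.prod := by rw [hprod]; group
    rw [← hlen]
    clear hlen hprod
    induction l generalizing a with
    | nil =>
      have h0 : (fun i => g (a * List.prod []) i - g a i) = (0 : I → ℝ) := by funext; simp
      refine ⟨h0 ▸ zero_memℓp, ?_⟩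
      have : Memℓp.toLp (h0 ▸ zero_memℓp) = (0 : lp (fun _ : I => ℝ) (ENNReal.ofReal p)) :=
        lp.ext h0
      rw [this]; simp
    | cons x l ih =>
      simp only [List.mem_cons, forall_eq_or_imp] at hl
      obtain ⟨h1, h1'⟩ := hstep a x hl.1
      obtain ⟨h2, h2'⟩ := ih (a * x) hl.2
      have h0 : (fun i => g (a * List.prod (x :: l)) i - g a i) =
          (fun i => g (a * x * l.prod) i - g (a * x) i) + (fun i => g (a * x) i - g a i) := by
        funext i; simp [mul_assoc]
      refine ⟨h0 ▸ h2.add h1, ?_⟩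
      have : Memℓp.toLp (h0 ▸ h2.add h1) = h2.toLp + h1.toLp := lp.ext h0
      rw [this]
      refine (norm_add_le _ _).trans ?_
      push_cast [List.length_cons]
      linarith
  obtain ⟨e, he⟩ := exists_isometry_lp_nat I hp
  choose hmem hnorm using hpath
  have hsub : ∀ a b, (hmem 1 a).toLp - (hmem 1 b).toLp = (hmem b a).toLp := fun a b => lp.ext <| by
    funext i
    change g a i - g 1 i - (g b i - g 1 i) = g a i - g b i
    ring
  refine ⟨fun a => e (hmem 1 a).toLp, fun a b => ⟨?_, ?_⟩⟩
  · rw [norm_sub_rev, he, hsub]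
    exact hnorm a b
  · rw [he, hsub, ofReal_norm_rpow_eq_tsum hp]
    rfl

end LpEmbedding

section SuffixTree

open scoped Classical

variable {A : Type*} (len : A → ℕ)

/-- The total length of a list of letters. -/
def totalLen (l : List A) : ℕ := (l.map len).sum

/-- The length of the first letter of a list. -/
def headLen : List A → ℕ
  | [] => 0
  | σ :: _ => len σ

@[simp]
theorem totalLen_nil : totalLen len [] = 0 := rfl

@[simp]
theorem totalLen_cons (σ : A) (l : List A) : totalLen len (σ :: l) = len σ + totalLen len l := by
  simp [totalLen]

@[simp]
theorem totalLen_append (l l' : List A) :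
    totalLen len (l ++ l') = totalLen len l + totalLen len l' := by
  simp [totalLen]

theorem totalLen_le_of_suffix {l l' : List A} (h : l <:+ l') : totalLen len l ≤ totalLen len l' := by
  obtain ⟨t, rfl⟩ := h
  simp

theorem not_cons_suffix (σ : A) (p t : List A) : ¬ σ :: (p ++ t) <:+ t := fun h => by
  have := h.length_le
  simp at this

/-- Two lists have a longest common suffix. -/
theorem exists_longest_common_suffix (l l' : List A) :
    ∃ u, u <:+ l ∧ u <:+ l' ∧ ∀ v, v <:+ l → v <:+ l' → v <:+ u := by
  induction l with
  | nil => exact ⟨[], List.nil_suffix, List.nil_suffix, fun v hv _ => hv⟩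
  | cons σ t ih =>
    by_cases h : σ :: t <:+ l'
    · exact ⟨σ :: t, List.suffix_rfl, h, fun v hv _ => hv⟩
    · obtain ⟨u, hu, hu', hmax⟩ := ih
      refine ⟨u, hu.trans (List.suffix_cons _ _), hu', fun v hv hv' => ?_⟩
      rcases List.suffix_cons_iff.1 hv with rfl | hv
      · exact absurd hv' h
      · exact hmax v hv hv'

theorem tsum_suffix_cons (f : List A → ℝ≥0∞) (σ : A) (t : List A) :
    ∑' u, (if u <:+ σ :: t then f u else 0) =
      f (σ :: t) + ∑' u, (if u <:+ t then f u else 0) := by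
  rw [ENNReal.tsum_eq_add_tsum_ite (σ :: t), if_pos List.suffix_rfl]
  congr 1
  refine tsum_congr fun u => ?_
  by_cases hu : u = σ :: t
  · subst hu
    have : ¬ σ :: t <:+ t := not_cons_suffix σ [] t
    simp [this]
  · simp [hu, List.suffix_cons_iff]

theorem tsum_suffix_near_le (R e : ℕ) (t : List A) :
    ∑' u, (if u <:+ t then (if e + (totalLen len t - totalLen len u) < R then
      ((min (headLen len u) R : ℕ) : ℝ≥0∞) else 0) else 0) ≤
      ((if e < R then 2 * R - e else 0 : ℕ) : ℝ≥0∞) := by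
  induction t generalizing e with
  | nil =>
    refine le_of_eq_of_le (ENNReal.tsum_eq_zero.2 fun u => ?_) zero_le
    split_ifs with h
    · rw [List.suffix_nil.1 h]; simp [headLen]
    · rfl
    · rfl
  | cons σ t ih =>
    rw [tsum_suffix_cons]
    have hcongr : ∀ u, (if u <:+ t then (if e + (totalLen len (σ :: t) - totalLen len u) < R then
        ((min (headLen len u) R : ℕ) : ℝ≥0∞) else 0) else 0) =
        (if u <:+ t then (if e + len σ + (totalLen len t - totalLen len u) < R then
        ((min (headLen len u) R : ℕ) : ℝ≥0∞) else 0) else 0) := fun u => by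
      by_cases hu : u <:+ t
      · have := totalLen_le_of_suffix len hu
        rw [totalLen_cons, show e + (len σ + totalLen len t - totalLen len u) =
          e + len σ + (totalLen len t - totalLen len u) by omega]
      · simp [hu]
    rw [tsum_congr hcongr]
    refine (add_le_add_right (ih (e + len σ)) _).trans ?_
    have : (if e + (totalLen len (σ :: t) - totalLen len (σ :: t)) < R then
        ((min (headLen len (σ :: t)) R : ℕ) : ℝ≥0∞) else 0) =
        ((if e < R then min (len σ) R else 0 : ℕ) : ℝ≥0∞) := by
      simp [headLen]
    rw [this, ← Nat.cast_add, Nat.cast_le]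
    split_ifs <;> omega

theorem totalLen_le_tsum_suffix_far (R e : ℕ) (q v : List A) (hq : ∀ σ ∈ q, len σ ≤ R) :
    (totalLen len q : ℝ≥0∞) ≤
      ∑' u, (if u <:+ q ++ v then (if u <:+ v then 0 else
        if R ≤ e + (totalLen len (q ++ v) - totalLen len u) then
          ((min (headLen len u) R : ℕ) : ℝ≥0∞) else 0) else 0) +
      ((if e < R then 2 * R - e else 0 : ℕ) : ℝ≥0∞) := by
  induction q generalizing e with
  | nil => simp
  | cons σ q ih =>
    simp only [List.mem_cons, forall_eq_or_imp] at hq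
    rw [List.cons_append, tsum_suffix_cons]
    have hcongr : ∀ u, (if u <:+ q ++ v then (if u <:+ v then 0 else
        if R ≤ e + (totalLen len (σ :: (q ++ v)) - totalLen len u) then
          ((min (headLen len u) R : ℕ) : ℝ≥0∞) else 0) else 0) =
        (if u <:+ q ++ v then (if u <:+ v then 0 else
        if R ≤ e + len σ + (totalLen len (q ++ v) - totalLen len u) then
          ((min (headLen len u) R : ℕ) : ℝ≥0∞) else 0) else 0) := fun u => by
      by_cases hu : u <:+ q ++ v
      · have := totalLen_le_of_suffix len hu
        rw [totalLen_cons, show e + (len σ + totalLen len (q ++ v) - totalLen len u) =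
          e + len σ + (totalLen len (q ++ v) - totalLen len u) by omega]
      · simp [hu]
    rw [tsum_congr hcongr]
    have hhead : (if σ :: (q ++ v) <:+ v then 0 else
        if R ≤ e + (totalLen len (σ :: (q ++ v)) - totalLen len (σ :: (q ++ v))) then
          ((min (headLen len (σ :: (q ++ v))) R : ℕ) : ℝ≥0∞) else 0) =
        ((if R ≤ e then len σ else 0 : ℕ) : ℝ≥0∞) := by
      simp [headLen, not_cons_suffix, hq.1]
    rw [hhead]
    have := ih (e + len σ) hq.2
    generalize (∑' u, (if u <:+ q ++ v then (if u <:+ v then 0 else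
        if R ≤ e + len σ + (totalLen len (q ++ v) - totalLen len u) then
          ((min (headLen len u) R : ℕ) : ℝ≥0∞) else 0) else 0)) = s at this ⊢
    have hσ := hq.1
    calc (totalLen len (σ :: q) : ℝ≥0∞) = len σ + totalLen len q := by simp
      _ ≤ len σ + (s + ((if e + len σ < R then 2 * R - (e + len σ) else 0 : ℕ) : ℝ≥0∞)) := by
        gcongr
      _ = s + ((len σ + if e + len σ < R then 2 * R - (e + len σ) else 0 : ℕ) : ℝ≥0∞) := by
        push_cast; ring
      _ ≤ s + (((if R ≤ e then len σ else 0) + if e < R then 2 * R - e else 0 : ℕ) : ℝ≥0∞) := by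
        refine add_le_add_right (Nat.cast_le.2 ?_) _
        split_ifs <;> omega
      _ = _ := by push_cast; ring

/-- The coordinates of a point at distance `e` beyond the word `l` in the tree of suffixes: the
coordinate of scale `2 ^ k` at the suffix `u` is the distance to `u` truncated at `2 ^ k`,
suitably weighted. -/
noncomputable def treeCoord (β p : ℝ) (e : ℕ) (l u : List A) (k : ℕ) : ℝ :=
  if u <:+ l then
    (min (e + (totalLen len l - totalLen len u)) (2 ^ k) : ℕ) * ((2 : ℝ) ^ k) ^ (β - 1) *
      ((min (headLen len u) (2 ^ k) : ℕ) / (2 : ℝ) ^ k) ^ (1 / p)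
  else 0

theorem treeCoord_cons (β p : ℝ) (σ : A) (l : List A) :
    treeCoord len β p 0 (σ :: l) = treeCoord len β p (len σ) l := by
  funext u k
  by_cases hu : u = σ :: l
  · subst hu
    have : ¬ σ :: l <:+ l := not_cons_suffix σ [] l
    simp [treeCoord, this]
  · simp only [treeCoord, List.suffix_cons_iff, hu, false_or]
    split_ifs with h
    · have := totalLen_le_of_suffix len h
      rw [totalLen_cons, show 0 + (len σ + totalLen len l - totalLen len u) =
        len σ + (totalLen len l - totalLen len u) by omega]
    · rfl

theorem abs_weight_rpow {p : ℝ} (hp : 1 ≤ p) (x w : ℝ) (hw : 0 ≤ w) (m R : ℕ) :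
    |x * w * ((m : ℝ) / R) ^ (1 / p)| ^ p = |x| ^ p * (w ^ p / R) * m := by
  have hp0 : 0 < p := by linarith
  rw [abs_mul, abs_mul, abs_of_nonneg hw, abs_of_nonneg (by positivity : 0 ≤ ((m : ℝ) / R) ^ (1 / p)),
    Real.mul_rpow (by positivity) (by positivity), Real.mul_rpow (by positivity) (by positivity),
    ← Real.rpow_mul (by positivity), one_div_mul_cancel hp0.ne', Real.rpow_one]
  ring

theorem tsum_treeCoord_sub_le {β p : ℝ} (hp : 1 ≤ p) {e e' : ℕ} (h : e ≤ e' + 1)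
    (h' : e' ≤ e + 1) (t : List A) (k : ℕ) :
    ∑' u, ENNReal.ofReal (|treeCoord len β p e t u k - treeCoord len β p e' t u k| ^ p) ≤
      ENNReal.ofReal (2 * (((2 : ℝ) ^ k) ^ (β - 1)) ^ p) := by
  have hp0 : 0 < p := by linarith
  set w : ℝ := ((2 : ℝ) ^ k) ^ (β - 1) with hw
  have hw0 : 0 ≤ w := by positivity
  have hR : ((2 ^ k : ℕ) : ℝ) = (2 : ℝ) ^ k := by push_cast; rfl
  calc ∑' u, ENNReal.ofReal (|treeCoord len β p e t u k - treeCoord len β p e' t u k| ^ p)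
      ≤ ∑' u, ENNReal.ofReal (w ^ p / (2 ^ k : ℕ)) *
        (if u <:+ t then (if 0 + (totalLen len t - totalLen len u) < 2 ^ k then
          ((min (headLen len u) (2 ^ k) : ℕ) : ℝ≥0∞) else 0) else 0) := by
        refine ENNReal.tsum_le_tsum fun u => ?_
        by_cases hu : u <:+ t
        · simp only [treeCoord, hu, if_true, ← hw, ← sub_mul]
          rw [← hR, abs_weight_rpow hp _ _ hw0]
          split_ifs with hlt
          · rw [← ENNReal.ofReal_natCast, ← ENNReal.ofReal_mul (by positivity)]
            refine ENNReal.ofReal_le_ofReal ?_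
            refine mul_le_mul_of_nonneg_right ?_ (by positivity)
            refine mul_le_of_le_one_left (by positivity) ?_
            refine Real.rpow_le_one (abs_nonneg _) ?_ hp0.le
            rw [abs_le]
            generalize totalLen len t - totalLen len u = r
            have h1 : min (e + r) (2 ^ k) ≤ min (e' + r) (2 ^ k) + 1 := by omega
            have h2 : min (e' + r) (2 ^ k) ≤ min (e + r) (2 ^ k) + 1 := by omega
            have h3 : ((min (e + r) (2 ^ k) : ℕ) : ℝ) ≤ (min (e' + r) (2 ^ k) : ℕ) + 1 := by
              exact_mod_cast h1
            have h4 : ((min (e' + r) (2 ^ k) : ℕ) : ℝ) ≤ (min (e + r) (2 ^ k) : ℕ) + 1 := by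
              exact_mod_cast h2
            constructor <;> linarith
          · rw [min_eq_right (by omega), min_eq_right (by omega)]
            simp [hp0.ne']
        · simp [treeCoord, hu, hp0.ne']
    _ ≤ ENNReal.ofReal (w ^ p / (2 ^ k : ℕ)) * ((2 * 2 ^ k : ℕ) : ℝ≥0∞) := by
        rw [ENNReal.tsum_mul_left]
        gcongr
        refine (tsum_suffix_near_le len (2 ^ k) 0 t).trans ?_
        simp
    _ = ENNReal.ofReal (2 * w ^ p) := by
        rw [← ENNReal.ofReal_natCast, ← ENNReal.ofReal_mul (by positivity)]
        congr 1
        push_cast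
        field_simp

theorem tsum_scale_lt_top {β p : ℝ} (hβ : β < 1) (hp : 1 ≤ p) :
    ∑' k : ℕ, ENNReal.ofReal (2 * (((2 : ℝ) ^ k) ^ (β - 1)) ^ p) ≠ ∞ := by
  have heq : ∀ k : ℕ, 2 * (((2 : ℝ) ^ k) ^ (β - 1)) ^ p = 2 * ((2 : ℝ) ^ ((β - 1) * p)) ^ k :=
    fun k => by
      rw [← Real.rpow_natCast, ← Real.rpow_natCast, ← Real.rpow_mul (by norm_num),
        ← Real.rpow_mul (by norm_num), ← Real.rpow_mul (by norm_num)]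
      ring_nf
  simp_rw [heq]
  have : Summable fun k : ℕ => 2 * ((2 : ℝ) ^ ((β - 1) * p)) ^ k :=
    (summable_geometric_of_lt_one (by positivity)
      (Real.rpow_lt_one_of_one_lt_of_neg (by norm_num) (by nlinarith))).mul_left 2
  exact this.tsum_ofReal_ne_top

theorem le_tsum_treeCoord_sub {β p : ℝ} (hp : 1 ≤ p) (k : ℕ) (q v l' : List A)
    (hq : ∀ σ ∈ q, len σ ≤ 2 ^ k) (hlen : 4 * 2 ^ k ≤ totalLen len q)
    (hl' : ∀ u, u <:+ q ++ v → u <:+ l' → u <:+ v) :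
    ENNReal.ofReal ((((2 : ℝ) ^ k) ^ β) ^ p) ≤
      ∑' u, ENNReal.ofReal
        (|treeCoord len β p 0 (q ++ v) u k - treeCoord len β p 0 l' u k| ^ p) := by
  have hp0 : 0 < p := by linarith
  set w : ℝ := ((2 : ℝ) ^ k) ^ (β - 1) with hw
  have hw0 : 0 ≤ w := by positivity
  have hR : ((2 ^ k : ℕ) : ℝ) = (2 : ℝ) ^ k := by push_cast; rfl
  have hRw : ((2 : ℝ) ^ k) ^ β = (2 ^ k : ℕ) * w := by
    rw [hw, hR, Real.rpow_sub_one (by positivity)]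
    field_simp
  have hfar := totalLen_le_tsum_suffix_far len (2 ^ k) 0 q v hq
  set s := ∑' u, (if u <:+ q ++ v then (if u <:+ v then 0 else
        if 2 ^ k ≤ 0 + (totalLen len (q ++ v) - totalLen len u) then
          ((min (headLen len u) (2 ^ k) : ℕ) : ℝ≥0∞) else 0) else 0) with hs
  have hs1 : ((2 ^ k : ℕ) : ℝ≥0∞) ≤ s := by
    have h1 : ((2 * 2 ^ k : ℕ) : ℝ≥0∞) + (2 * 2 ^ k : ℕ) ≤ s + (2 * 2 ^ k : ℕ) := by
      refine le_trans ?_ (hfar.trans ?_)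
      · rw [← Nat.cast_add, Nat.cast_le]; omega
      · simp
    refine le_trans ?_ ((ENNReal.add_le_add_iff_right (ENNReal.natCast_ne_top _)).1 h1)
    rw [Nat.cast_le]; omega
  calc ENNReal.ofReal ((((2 : ℝ) ^ k) ^ β) ^ p)
      = ENNReal.ofReal (((2 ^ k : ℕ) : ℝ) ^ p * (w ^ p / (2 ^ k : ℕ))) * (2 ^ k : ℕ) := by
        rw [← ENNReal.ofReal_natCast, ← ENNReal.ofReal_mul (by positivity), hRw,
          Real.mul_rpow (by positivity) hw0]
        congr 1
        field_simp
    _ ≤ ENNReal.ofReal (((2 ^ k : ℕ) : ℝ) ^ p * (w ^ p / (2 ^ k : ℕ))) * s := by gcongr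
    _ ≤ _ := by
        rw [hs, ← ENNReal.tsum_mul_left]
        refine ENNReal.tsum_le_tsum fun u => ?_
        by_cases hu : u <:+ q ++ v
        · by_cases huv : u <:+ v
          · simp [huv]
          · have hul' : ¬ u <:+ l' := fun h => huv (hl' u hu h)
            simp only [hu, huv, if_true, if_false]
            split_ifs with hle
            · rw [← ENNReal.ofReal_natCast, ← ENNReal.ofReal_mul (by positivity)]
              refine ENNReal.ofReal_le_ofReal ?_
              simp only [treeCoord, hu, hul', if_true, if_false, sub_zero, ← hw]
              rw [← hR, abs_weight_rpow hp _ _ hw0, min_eq_right hle, abs_of_nonneg (by positivity)]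
            · simp
        · simp [hu]

end SuffixTree

section FreeProduct

open scoped Classical
open Monoid CoprodI

variable {ι : Type*} {M : ι → Type*} [∀ i, Group (M i)]

/-- The element of the free product spelled by a list of syllables. -/
noncomputable def evalList (l : List (Σ i, M i)) : CoprodI M :=
  (l.map fun σ => of σ.2).prod

@[simp]
theorem evalList_nil : evalList ([] : List (Σ i, M i)) = 1 := rfl

@[simp]
theorem evalList_cons (σ : Σ i, M i) (l : List (Σ i, M i)) :
    evalList (σ :: l) = of σ.2 * evalList l := by
  simp [evalList]

@[simp]
theorem evalList_append (l l' : List (Σ i, M i)) :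
    evalList (l ++ l') = evalList l * evalList l' := by
  simp [evalList]

/-- The syllables of the reduced word representing the inverse of `a`, so that the last syllable
of `a` comes first. -/
noncomputable def syllables (a : CoprodI M) : List (Σ i, M i) := (Word.equiv a⁻¹).toList

theorem evalList_syllables (a : CoprodI M) : evalList (syllables a) = a⁻¹ :=
  Word.equiv.symm_apply_apply a⁻¹

/-- Prepend a syllable to a list, unless it is trivial. -/
noncomputable def consSyllable (i : ι) (h : M i) (t : List (Σ i, M i)) : List (Σ i, M i) :=
  if h = 1 then t else ⟨i, h⟩ :: t

theorem toList_rcons {i : ι} (q : Word.Pair M i) :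
    (Word.rcons q).toList = consSyllable i q.head q.tail.toList := by
  unfold Word.rcons consSyllable
  split_ifs <;> rfl

theorem exists_syllables_mul_of (a : CoprodI M) (i : ι) (x : M i) :
    ∃ (h : M i) (t : List (Σ i, M i)), syllables a = consSyllable i h t ∧
      syllables (a * of x) = consSyllable i (x⁻¹ * h) t := by
  refine ⟨(Word.equivPair i (Word.equiv a⁻¹)).head,
    (Word.equivPair i (Word.equiv a⁻¹)).tail.toList, ?_, ?_⟩
  · rw [← toList_rcons, ← Word.equivPair_symm, Equiv.symm_apply_apply]
    rfl
  · have : Word.equiv (a * of x)⁻¹ = of x⁻¹ • Word.equiv a⁻¹ := by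
      rw [mul_inv_rev, ← map_inv]
      exact mul_smul (of x⁻¹) a⁻¹ (Word.empty : Word M)
    rw [syllables, this, Word.of_smul_def, toList_rcons]

/-- The syllable of `l` preceding the suffix `u`, as an element of the direct product; it is
trivial if there is no such syllable. -/
noncomputable def syllableAt : List (Σ i, M i) → List (Σ i, M i) → ∀ i, M i
  | [], _ => 1
  | σ :: t, u => if u = t then Pi.mulSingle σ.1 σ.2 else syllableAt t u

theorem exists_cons_suffix_of_syllableAt_ne_one {l u : List (Σ i, M i)} (h : syllableAt l u ≠ 1) :
    ∃ σ, σ :: u <:+ l := by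
  induction l with
  | nil => exact absurd rfl h
  | cons σ t ih =>
    by_cases hu : u = t
    · exact ⟨σ, hu ▸ List.suffix_rfl⟩
    · rw [syllableAt, if_neg hu] at h
      obtain ⟨τ, hτ⟩ := ih h
      exact ⟨τ, hτ.trans (List.suffix_cons _ _)⟩

theorem syllableAt_self (l : List (Σ i, M i)) : syllableAt l l = 1 := by
  by_contra h
  obtain ⟨σ, hσ⟩ := exists_cons_suffix_of_syllableAt_ne_one h
  exact not_cons_suffix σ [] l hσ

theorem syllableAt_append_cons (q : List (Σ i, M i)) (σ : Σ i, M i) (u : List (Σ i, M i)) :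
    syllableAt (q ++ σ :: u) u = Pi.mulSingle σ.1 σ.2 := by
  induction q with
  | nil => simp [syllableAt]
  | cons τ q ih =>
    rw [List.cons_append, syllableAt, if_neg, ih]
    intro h
    have := congrArg List.length h
    simp at this
    omega

theorem syllableAt_consSyllable (i : ι) (h : M i) (t u : List (Σ i, M i)) :
    syllableAt (consSyllable i h t) u = if u = t then Pi.mulSingle i h else syllableAt t u := by
  unfold consSyllable
  split_ifs with h1 h2 h2
  · rw [h1, h2, syllableAt_self, Pi.mulSingle_one]
  · rfl
  · simp [syllableAt, h2]
  · simp [syllableAt, h2]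

variable (S : ∀ i, Set (M i))

/-- The word length of a syllable. -/
noncomputable def syllableLen (σ : Σ i, M i) : ℕ := wordNorm (S σ.1) σ.2

theorem treeCoord_consSyllable (β p : ℝ) (i : ι) (h : M i) (t : List (Σ i, M i)) :
    treeCoord (syllableLen S) β p 0 (consSyllable i h t) =
      treeCoord (syllableLen S) β p (wordNorm (S i) h) t := by
  unfold consSyllable
  split_ifs with h1
  · rw [h1, wordNorm_one]
  · exact treeCoord_cons _ _ _ _ _

/-- The generating set of a free product induced by generating sets of the factors. -/
def freeProductGens : Set (CoprodI M) := ⋃ i, of '' S i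

variable {S}

theorem closure_freeProductGens (hS : ∀ i, Subgroup.closure (S i) = ⊤) :
    Subgroup.closure (freeProductGens S) = ⊤ := by
  rw [eq_top_iff]
  rintro g -
  induction g using CoprodI.induction_on with
  | one => exact one_mem _
  | of i m =>
    have : of m ∈ (Subgroup.closure (S i)).map (of : M i →* CoprodI M) :=
      ⟨m, by rw [hS i]; trivial, rfl⟩
    rw [MonoidHom.map_closure] at this
    exact Subgroup.closure_mono (Set.subset_iUnion (fun i => of '' S i) i) this
  | mul x y hx hy => exact mul_mem hx hy

theorem wordNorm_of_le (hS : ∀ i, Subgroup.closure (S i) = ⊤) (i : ι) (g : M i) :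
    wordNorm (freeProductGens S) (of g) ≤ wordNorm (S i) g :=
  wordNorm_map_le (hS i) (closure_freeProductGens hS) of
    (fun s hs => .inl (Set.mem_iUnion.2 ⟨i, s, hs, rfl⟩)) g

theorem wordNorm_evalList_le (hS : ∀ i, Subgroup.closure (S i) = ⊤) (l : List (Σ i, M i)) :
    wordNorm (freeProductGens S) (evalList l) ≤ totalLen (syllableLen S) l := by
  induction l with
  | nil => simp
  | cons σ l ih =>
    rw [evalList_cons, totalLen_cons]
    exact (wordNorm_mul_le (closure_freeProductGens hS) _ _).trans
      (add_le_add (wordNorm_of_le hS _ _) ih)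

/-- Two elements of the direct product with at most one nontrivial entry each: the quotient of the
corresponding elements of the free product is controlled by a single coordinate. -/
theorem exists_wordNorm_of_mul_inv_le (hS : ∀ i, Subgroup.closure (S i) = ⊤) (i j : ι) (g : M i)
    (h : M j) : ∃ m, wordNorm (freeProductGens S) (of g * (of h)⁻¹) ≤
      2 * wordNorm (S m) ((Pi.mulSingle i g : ∀ i, M i) m * (Pi.mulSingle j h m)⁻¹) := by
  by_cases hij : i = j
  · subst hij
    refine ⟨i, ?_⟩
    have := wordNorm_of_le hS i (g * h⁻¹)
    rw [map_mul, map_inv] at this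
    simp only [Pi.mulSingle_eq_same]
    omega
  · have h1 := wordNorm_mul_le (closure_freeProductGens hS) (of g) (of h)⁻¹
    rw [wordNorm_inv (closure_freeProductGens hS)] at h1
    have h2 := wordNorm_of_le hS i g
    have h3 := wordNorm_of_le hS j h
    rcases le_total (wordNorm (S i) g) (wordNorm (S j) h) with hle | hle
    · refine ⟨j, ?_⟩
      rw [Pi.mulSingle_eq_of_ne (Ne.symm hij), Pi.mulSingle_eq_same, one_mul, wordNorm_inv (hS j)]
      omega
    · refine ⟨i, ?_⟩
      rw [Pi.mulSingle_eq_of_ne hij, Pi.mulSingle_eq_same, inv_one, mul_one]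
      omega

/-- Split a list of syllables at a suffix `u` and the syllable preceding it. -/
theorem exists_split_at_suffix [Nonempty ι] {l u : List (Σ i, M i)} (h : u <:+ l) :
    ∃ (q v : List (Σ i, M i)) (i : ι) (g : M i), l = q ++ v ∧ u <:+ v ∧
      (q ≠ [] → u.length < v.length) ∧ evalList v = of g * evalList u ∧
      syllableAt l u = Pi.mulSingle i g := by
  obtain ⟨r, rfl⟩ := h
  rcases List.eq_nil_or_concat r with rfl | ⟨q, σ, rfl⟩
  · obtain ⟨i⟩ := ‹Nonempty ι›
    exact ⟨[], u, i, 1, rfl, List.suffix_rfl, fun h => absurd rfl h, by simp,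
      by simp [syllableAt_self]⟩
  · exact ⟨q, σ :: u, σ.1, σ.2, by simp, List.suffix_cons _ _, fun _ => by simp, by simp,
      by simp [syllableAt_append_cons]⟩

variable {p β C : ℝ} {φ : ∀ i, M i → lp (fun _ : ℕ => ℝ) (ENNReal.ofReal p)}

/-- A long segment of a geodesic after branching forces a large displacement: either it contains
a long syllable, seen by the embedding of a factor, or it is seen by the tree coordinates. -/
theorem le_of_long_segment (hp : 1 ≤ p) (hβ : 0 ≤ β) (hC : 0 < C)
    (hφ : ∀ i x y, C⁻¹ * wordDist (S i) x y ^ β - C ≤ ‖φ i x - φ i y‖)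
    {X : ℝ} (hX : 0 ≤ X) {q u v l' : List (Σ i, M i)} (huv : u <:+ v)
    (hlen : q ≠ [] → u.length < v.length) (hmax : ∀ w, w <:+ q ++ v → w <:+ l' → w <:+ u)
    (hX1 : ∀ w j, ‖φ j (syllableAt (q ++ v) w j)⁻¹ - φ j (syllableAt l' w j)⁻¹‖ ≤ X)
    (hX2 : ∀ k, ∑' w, ENNReal.ofReal (|treeCoord (syllableLen S) β p 0 (q ++ v) w k -
      treeCoord (syllableLen S) β p 0 l' w k| ^ p) ≤ ENNReal.ofReal (X ^ p))
    {k : ℕ} (hk : 4 * 2 ^ k ≤ totalLen (syllableLen S) q) :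
    min C⁻¹ 1 * ((2 : ℝ) ^ k) ^ β - C ≤ X := by
  have hp0 : 0 < p := by linarith
  have hpow : 0 ≤ ((2 : ℝ) ^ k) ^ β := by positivity
  by_cases hq : ∀ σ ∈ q, syllableLen S σ ≤ 2 ^ k
  · have h1 := (le_tsum_treeCoord_sub (syllableLen S) (β := β) hp k q v l' hq hk
      (fun w hw hw' => (hmax w hw hw').trans huv)).trans (hX2 k)
    rw [ENNReal.ofReal_le_ofReal_iff (by positivity),
      Real.rpow_le_rpow_iff hpow hX hp0] at h1
    have : min C⁻¹ 1 * ((2 : ℝ) ^ k) ^ β ≤ 1 * ((2 : ℝ) ^ k) ^ β := by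
      gcongr
      exact min_le_right _ _
    linarith
  · push Not at hq
    obtain ⟨σ, hσ, hlt⟩ := hq
    obtain ⟨q₁, q₂, rfl⟩ := List.append_of_mem hσ
    have h1 := hX1 (q₂ ++ v) σ.1
    have hl' : syllableAt l' (q₂ ++ v) = 1 := by
      by_contra hne
      obtain ⟨τ, hτ⟩ := exists_cons_suffix_of_syllableAt_ne_one hne
      have h2 := hmax (q₂ ++ v) ⟨q₁ ++ [σ], by simp⟩ ((List.suffix_cons _ _).trans hτ)
      have h3 := h2.length_le
      have h4 := hlen (by simp)
      rw [List.length_append] at h3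
      omega
    rw [hl', List.append_assoc, List.cons_append, syllableAt_append_cons,
      Pi.mulSingle_eq_same] at h1
    have h2 := (hφ _ _ _).trans h1
    simp only [wordDist, inv_inv, Pi.one_apply, inv_one, mul_one] at h2
    have h3 : ((2 : ℝ) ^ k) ^ β ≤ (wordNorm (S σ.1) σ.2 : ℝ) ^ β := by
      refine Real.rpow_le_rpow (by positivity) ?_ hβ
      exact_mod_cast hlt.le
    have h4 : min C⁻¹ 1 * ((2 : ℝ) ^ k) ^ β ≤ C⁻¹ * (wordNorm (S σ.1) σ.2 : ℝ) ^ β :=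
      mul_le_mul (min_le_left _ _) h3 hpow (by positivity)
    linarith

/-- The lower bound for pairs of words at distance at least `16 * 2 ^ k`. -/
theorem le_of_long_wordNorm [Nonempty ι] (hS : ∀ i, Subgroup.closure (S i) = ⊤) (hp : 1 ≤ p)
    (hβ : 0 ≤ β) (hC : 0 < C)
    (hφ : ∀ i x y, C⁻¹ * wordDist (S i) x y ^ β - C ≤ ‖φ i x - φ i y‖)
    {X : ℝ} (hX : 0 ≤ X) {l l' : List (Σ i, M i)}
    (hX1 : ∀ w j, ‖φ j (syllableAt l w j)⁻¹ - φ j (syllableAt l' w j)⁻¹‖ ≤ X)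
    (hX2 : ∀ k, ∑' w, ENNReal.ofReal (|treeCoord (syllableLen S) β p 0 l w k -
      treeCoord (syllableLen S) β p 0 l' w k| ^ p) ≤ ENNReal.ofReal (X ^ p))
    {k : ℕ} (hk : 16 * 2 ^ k ≤ wordNorm (freeProductGens S) (evalList l * (evalList l')⁻¹)) :
    min C⁻¹ 1 * ((2 : ℝ) ^ k) ^ β - C ≤ X := by
  have hgen := closure_freeProductGens hS
  have : Fact (1 ≤ ENNReal.ofReal p) := ⟨by simpa using hp⟩
  obtain ⟨u, hu, hu', hmax⟩ := exists_longest_common_suffix l l'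
  obtain ⟨q, v, i, g, rfl, huv, hlen, hv, hat⟩ := exists_split_at_suffix hu
  obtain ⟨q', v', j, h, rfl, huv', hlen', hv', hat'⟩ := exists_split_at_suffix hu'
  obtain ⟨m, hm⟩ := exists_wordNorm_of_mul_inv_le hS i j g h
  rw [← hat, ← hat'] at hm
  have hdist : wordNorm (freeProductGens S) (evalList (q ++ v) * (evalList (q' ++ v'))⁻¹) ≤
      totalLen (syllableLen S) q + wordNorm (freeProductGens S) (of g * (of h)⁻¹) +
        totalLen (syllableLen S) q' := by
    have heq : evalList (q ++ v) * (evalList (q' ++ v'))⁻¹ =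
        evalList q * (of g * (of h)⁻¹) * (evalList q')⁻¹ := by
      rw [evalList_append, evalList_append, hv, hv']
      group
    rw [heq]
    refine (wordNorm_mul_le hgen _ _).trans ?_
    rw [wordNorm_inv hgen]
    exact add_le_add ((wordNorm_mul_le hgen _ _).trans
      (add_le_add_left (wordNorm_evalList_le hS q) _)) (wordNorm_evalList_le hS q')
  by_cases h1 : 4 * 2 ^ k ≤ totalLen (syllableLen S) q
  · exact le_of_long_segment hp hβ hC hφ hX huv hlen hmax hX1 hX2 h1
  by_cases h2 : 4 * 2 ^ k ≤ totalLen (syllableLen S) q'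
  · refine le_of_long_segment hp hβ hC hφ hX huv' hlen' (fun w hw hw' => hmax w hw' hw)
      (fun w j => ?_) (fun k => ?_) h2
    · rw [norm_sub_rev]
      exact hX1 w j
    · simp_rw [abs_sub_comm (treeCoord (syllableLen S) β p 0 (q' ++ v') _ k)]
      exact hX2 k
  have h3 := (hφ _ _ _).trans (hX1 u m)
  simp only [wordDist, inv_inv] at h3
  have h4 : ((2 : ℝ) ^ k) ^ β ≤ (wordNorm (S m)
      (syllableAt (q ++ v) u m * (syllableAt (q' ++ v') u m)⁻¹) : ℝ) ^ β := by
    refine Real.rpow_le_rpow (by positivity) ?_ hβ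
    have : 2 ^ k ≤ wordNorm (S m)
      (syllableAt (q ++ v) u m * (syllableAt (q' ++ v') u m)⁻¹) := by omega
    exact_mod_cast this
  have h5 := mul_le_mul (min_le_left C⁻¹ 1) h4 (by positivity) (by positivity)
  linarith

/-- The coordinates of a list of syllables in the embedding of a free product. -/
noncomputable def freeProductCoord (S : ∀ i, Set (M i)) (β : ℝ)
    (φ : ∀ i, M i → lp (fun _ : ℕ => ℝ) (ENNReal.ofReal p)) (l : List (Σ i, M i)) :
    List (Σ i, M i) × ι × ℕ ⊕ ℕ × List (Σ i, M i) → ℝ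
  | .inl (u, j, n) => φ j (syllableAt l u j)⁻¹ n
  | .inr (k, u) => treeCoord (syllableLen S) β p 0 l u k

theorem tsum_freeProductCoord_sub_le (hS : ∀ i, Subgroup.closure (S i) = ⊤) (hp : 1 ≤ p)
    (hC : 0 < C) (hφ : ∀ i x y, ‖φ i x - φ i y‖ ≤ C * wordDist (S i) x y + C)
    {i : ι} {x : M i} (hx : x ∈ S i) (h : M i) (t : List (Σ i, M i)) :
    ∑' c, ENNReal.ofReal (|freeProductCoord S β φ (consSyllable i (x⁻¹ * h) t) c -
        freeProductCoord S β φ (consSyllable i h t) c| ^ p) ≤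
      ENNReal.ofReal ((2 * C) ^ p) +
        ∑' k : ℕ, ENNReal.ofReal (2 * (((2 : ℝ) ^ k) ^ (β - 1)) ^ p) := by
  have hp0 : 0 < p := by linarith
  have : Fact (1 ≤ ENNReal.ofReal p) := ⟨by simpa using hp⟩
  have hx1 : wordNorm (S i) x ≤ 1 := wordNorm_le_one (.inl hx)
  rw [Summable.tsum_sum ENNReal.summable ENNReal.summable]
  refine add_le_add ?_ ?_
  · rw [ENNReal.tsum_prod', tsum_eq_single t, ENNReal.tsum_prod', tsum_eq_single i]
    · simp only [freeProductCoord, syllableAt_consSyllable, if_true, Pi.mulSingle_eq_same]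
      have h1 := ofReal_norm_rpow_eq_tsum hp (φ i (x⁻¹ * h)⁻¹ - φ i h⁻¹)
      simp only [lp.coeFn_sub, Pi.sub_apply] at h1
      rw [← h1]
      refine ENNReal.ofReal_le_ofReal (Real.rpow_le_rpow (norm_nonneg _) ?_ hp0.le)
      refine (hφ _ _ _).trans ?_
      have h2 : wordDist (S i) (x⁻¹ * h)⁻¹ h⁻¹ ≤ 1 := by
        rw [wordDist, inv_inv, mul_assoc, mul_inv_cancel, mul_one, wordNorm_inv (hS i)]
        exact_mod_cast hx1
      nlinarith
    · intro j hj
      simp [freeProductCoord, syllableAt_consSyllable, Pi.mulSingle_eq_of_ne hj, hp0.ne']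
    · intro u hu
      simp [freeProductCoord, syllableAt_consSyllable, hu, hp0.ne']
  · rw [ENNReal.tsum_prod']
    refine ENNReal.tsum_le_tsum fun k => ?_
    simp only [freeProductCoord, treeCoord_consSyllable]
    have h1 := wordNorm_mul_le (hS i) x⁻¹ h
    have h2 := wordNorm_mul_le (hS i) x (x⁻¹ * h)
    rw [wordNorm_inv (hS i)] at h1
    rw [mul_inv_cancel_left] at h2
    exact tsum_treeCoord_sub_le _ hp (by omega) (by omega) t k

/-- Factors that embed into `ℓ^p` with compression exponent `β < 1` yield such an embedding of
their free product. -/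
theorem exists_embedding_coprodI [Nonempty ι] [Countable ι] [∀ i, Countable (M i)]
    (hS : ∀ i, Subgroup.closure (S i) = ⊤) (hp : 1 ≤ p) (hβ : 0 ≤ β) (hβ1 : β < 1) (hC : 0 < C)
    (hφ : ∀ i x y, C⁻¹ * wordDist (S i) x y ^ β - C ≤ ‖φ i x - φ i y‖ ∧
      ‖φ i x - φ i y‖ ≤ C * wordDist (S i) x y + C) :
    ∃ (F : CoprodI M → lp (fun _ : ℕ => ℝ) (ENNReal.ofReal p)) (K : ℝ), 0 < K ∧ ∀ x y,
      K⁻¹ * wordDist (freeProductGens S) x y ^ β - K ≤ ‖F x - F y‖ ∧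
        ‖F x - F y‖ ≤ K * wordDist (freeProductGens S) x y + K := by
  have hp0 : 0 < p := by linarith
  have : Fact (1 ≤ ENNReal.ofReal p) := ⟨by simpa using hp⟩
  set Q := ENNReal.ofReal ((2 * C) ^ p) +
    ∑' k : ℕ, ENNReal.ofReal (2 * (((2 : ℝ) ^ k) ^ (β - 1)) ^ p) with hQ
  have hQtop : Q ≠ ∞ := ENNReal.add_ne_top.2 ⟨ENNReal.ofReal_ne_top, tsum_scale_lt_top hβ1 hp⟩
  set B := Q.toReal ^ (1 / p) with hB
  have hBQ : ENNReal.ofReal (B ^ p) = Q := by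
    rw [hB, ← Real.rpow_mul ENNReal.toReal_nonneg, one_div_mul_cancel hp0.ne', Real.rpow_one,
      ENNReal.ofReal_toReal hQtop]
  have hB0 : 0 ≤ B := by positivity
  obtain ⟨F, hF⟩ := exists_lipschitz_lp (closure_freeProductGens hS) hp
    (fun a => freeProductCoord S β φ (syllables a)) hB0 (by
      rintro a _ hx
      obtain ⟨i, x, hxS, rfl⟩ := Set.mem_iUnion.1 hx
      obtain ⟨h, t, h1, h2⟩ := exists_syllables_mul_of a i x
      rw [h1, h2, hBQ]
      exact tsum_freeProductCoord_sub_le hS hp hC (fun i x y => (hφ i x y).2) hxS h t)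
  set κ := min C⁻¹ 1 with hκ
  have hκ0 : 0 < κ := lt_min (by positivity) one_pos
  set K := max (max B C) (max 16 (32 / κ)) with hK
  have hKB : B ≤ K := (le_max_left _ _).trans (le_max_left _ _)
  have hKC : C ≤ K := (le_max_right _ _).trans (le_max_left _ _)
  have hK16 : 16 ≤ K := (le_max_left _ _).trans (le_max_right _ _)
  have hKκ : 32 / κ ≤ K := (le_max_right _ _).trans (le_max_right _ _)
  have hK0 : 0 < K := by linarith
  refine ⟨F, K, hK0, fun a b => ⟨?_, ?_⟩⟩
  · set N := wordNorm (freeProductGens S) (a⁻¹ * b) with hN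
    have hd : wordDist (freeProductGens S) a b = N := rfl
    rw [hd]
    rcases lt_or_ge N 16 with hlt | hge
    · have h1 : (N : ℝ) ^ β ≤ 16 := by
        have h2 : (N : ℝ) ≤ 16 := by exact_mod_cast hlt.le
        calc (N : ℝ) ^ β ≤ 16 ^ β := Real.rpow_le_rpow (by positivity) h2 hβ
          _ ≤ 16 ^ (1 : ℝ) := Real.rpow_le_rpow_of_exponent_le (by norm_num) hβ1.le
          _ = 16 := Real.rpow_one _
      have h2 : K⁻¹ * (N : ℝ) ^ β ≤ 1 := by
        rw [inv_mul_le_iff₀ hK0]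
        linarith
      linarith [norm_nonneg (F a - F b)]
    · obtain ⟨k, hk1, hk2⟩ : ∃ k, 16 * 2 ^ k ≤ N ∧ N < 32 * 2 ^ k := by
        have hne : N / 16 ≠ 0 := by omega
        refine ⟨Nat.log 2 (N / 16), ?_, ?_⟩
        · have := Nat.pow_log_le_self 2 hne
          omega
        · have := Nat.lt_pow_succ_log_self (b := 2) (by norm_num) (N / 16)
          rw [pow_succ] at this
          omega
      have hX := (hF a b).2
      have h1 : κ * ((2 : ℝ) ^ k) ^ β - C ≤ ‖F a - F b‖ := by
        refine le_of_long_wordNorm (l := syllables a) (l' := syllables b) hS hp hβ hC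
          (fun i x y => (hφ i x y).1) (norm_nonneg _) (fun w j => ?_) (fun k => ?_) ?_
        · rw [← Real.rpow_le_rpow_iff (norm_nonneg _) (norm_nonneg _) hp0,
            ← ENNReal.ofReal_le_ofReal_iff (by positivity), hX, ofReal_norm_rpow_eq_tsum hp]
          refine le_trans (le_of_eq ?_) (ENNReal.tsum_comp_le_tsum_of_injective
            (f := fun n : ℕ => Sum.inl (w, j, n)) (fun m n hmn => by simpa using hmn) _)
          rfl
        · rw [hX]
          refine le_trans (le_of_eq ?_) (ENNReal.tsum_comp_le_tsum_of_injective
            (f := fun w => Sum.inr (k, w)) (fun m n hmn => by simpa using hmn) _)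
          rfl
        · rw [evalList_syllables, evalList_syllables, inv_inv]
          exact hk1
      have h2 : (N : ℝ) ^ β ≤ 32 * ((2 : ℝ) ^ k) ^ β := by
        have h3 : (N : ℝ) ≤ 32 * 2 ^ k := by exact_mod_cast hk2.le
        calc (N : ℝ) ^ β ≤ (32 * 2 ^ k) ^ β := Real.rpow_le_rpow (by positivity) h3 hβ
          _ = 32 ^ β * ((2 : ℝ) ^ k) ^ β := Real.mul_rpow (by norm_num) (by positivity)
          _ ≤ 32 ^ (1 : ℝ) * ((2 : ℝ) ^ k) ^ β := by
            gcongr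
            · norm_num
          _ = _ := by rw [Real.rpow_one]
      have h3 : K⁻¹ * (N : ℝ) ^ β ≤ κ * ((2 : ℝ) ^ k) ^ β := by
        rw [inv_mul_le_iff₀ hK0]
        have h4 : 32 ≤ K * κ := by rwa [div_le_iff₀ hκ0] at hKκ
        calc (N : ℝ) ^ β ≤ 32 * ((2 : ℝ) ^ k) ^ β := h2
          _ ≤ K * κ * ((2 : ℝ) ^ k) ^ β := by gcongr
          _ = _ := by ring
      linarith
  · refine (hF a b).1.trans ?_
    have := wordDist_nonneg (S := freeProductGens S) a b
    nlinarith

end FreeProduct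

section CompressionExponent

variable {X Y : Type*} {d : X → X → ℝ} {e : Y → Y → ℝ} {p α γ C C' : ℝ}

/-- `d` has `ℓ^p` compression at least `α`, with constant `C`. -/
def HasCompression (p α C : ℝ) (d : X → X → ℝ) : Prop :=
  ∃ φ : X → lp (fun _ : ℕ => ℝ) (ENNReal.ofReal p),
    ∀ x y, C⁻¹ * d x y ^ α - C ≤ ‖φ x - φ y‖ ∧ ‖φ x - φ y‖ ≤ C * d x y + C

theorem compExp_eq_sSup (p : ℝ) (d : X → X → ℝ) :
    compExp p d = sSup {α | 0 ≤ α ∧ α ≤ 1 ∧ ∃ C, 0 < C ∧ HasCompression p α C d} := by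
  unfold compExp HasCompression
  congr 1
  ext α
  simp only [Set.mem_ofPred_eq]
  constructor
  · rintro ⟨h0, h1, φ, C, hC, h⟩
    exact ⟨h0, h1, C, hC, φ, h⟩
  · rintro ⟨h0, h1, C, hC, φ, h⟩
    exact ⟨h0, h1, φ, C, hC, h⟩

theorem HasCompression.comp (h : HasCompression p α C e) (f : X → Y)
    (hf : ∀ x y, e (f x) (f y) = d x y) : HasCompression p α C d := by
  obtain ⟨φ, hφ⟩ := h
  exact ⟨φ ∘ f, fun x y => by rw [← hf]; exact hφ (f x) (f y)⟩

theorem HasCompression.mono_const (h : HasCompression p α C d) (hd : ∀ x y, 0 ≤ d x y)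
    (hC : 0 < C) (hCC' : C ≤ C') : HasCompression p α C' d := by
  obtain ⟨φ, hφ⟩ := h
  refine ⟨φ, fun x y => ⟨le_trans ?_ (hφ x y).1, (hφ x y).2.trans ?_⟩⟩
  · have := mul_le_mul_of_nonneg_right (inv_anti₀ hC hCC') (Real.rpow_nonneg (hd x y) α)
    linarith
  · have := mul_le_mul_of_nonneg_right hCC' (hd x y)
    linarith

theorem HasCompression.anti {Γ : Type*} [Group Γ] {S : Set Γ}
    (h : HasCompression p α C (wordDist S)) (hC : 0 < C) (hγα : γ ≤ α) :
    HasCompression p γ (C + 1) (wordDist S) := by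
  obtain ⟨φ, hφ⟩ := h
  refine ⟨φ, fun x y => ⟨le_trans ?_ (hφ x y).1, (hφ x y).2.trans ?_⟩⟩
  · set n := wordNorm S (x⁻¹ * y) with hn
    have hd : wordDist S x y = n := rfl
    rw [hd]
    have hpow : (n : ℝ) ^ γ ≤ (n : ℝ) ^ α + 1 := by
      rcases Nat.eq_zero_or_pos n with h0 | h0
      · rw [h0, Nat.cast_zero]
        have := Real.zero_rpow_le_one γ
        have := Real.zero_rpow_nonneg α
        linarith
      · have := Real.rpow_le_rpow_of_exponent_le (x := n) (by exact_mod_cast h0) hγα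
        linarith
    have h1 : (C + 1)⁻¹ * (n : ℝ) ^ γ ≤ (C + 1)⁻¹ * ((n : ℝ) ^ α + 1) := by gcongr
    have h2 : (C + 1)⁻¹ ≤ 1 := inv_le_one_of_one_le₀ (by linarith)
    have h3 : (C + 1)⁻¹ * (n : ℝ) ^ α ≤ C⁻¹ * (n : ℝ) ^ α := by
      gcongr
      linarith
    linarith
  · have := wordDist_nonneg (S := S) x y
    linarith

theorem bddAbove_compression (p : ℝ) (d : X → X → ℝ) :
    BddAbove {α | 0 ≤ α ∧ α ≤ 1 ∧ ∃ C, 0 < C ∧ HasCompression p α C d} :=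
  ⟨1, fun _ h => h.2.1⟩

theorem nonempty_compression (hp : 1 ≤ p) (hd : ∀ x y, 0 ≤ d x y) :
    {α | 0 ≤ α ∧ α ≤ 1 ∧ ∃ C, 0 < C ∧ HasCompression p α C d}.Nonempty := by
  have : Fact (1 ≤ ENNReal.ofReal p) := ⟨by simpa using hp⟩
  refine ⟨0, le_rfl, zero_le_one, 1, one_pos, 0, fun x y => ?_⟩
  have := hd x y
  simpa using by linarith

theorem compExp_nonneg (p : ℝ) (d : X → X → ℝ) : 0 ≤ compExp p d :=
  Real.sSup_nonneg fun _ h => h.1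

theorem compExp_le_of_isometry (hp : 1 ≤ p) (he : ∀ x y, 0 ≤ e x y) (f : X → Y)
    (hf : ∀ x y, e (f x) (f y) = d x y) : compExp p e ≤ compExp p d := by
  rw [compExp_eq_sSup, compExp_eq_sSup]
  refine csSup_le_csSup (bddAbove_compression p d) (nonempty_compression hp he) ?_
  rintro α ⟨h0, h1, C, hC, h⟩
  exact ⟨h0, h1, C, hC, h.comp f hf⟩

theorem exists_hasCompression_of_lt {Γ : Type*} [Group Γ] {S : Set Γ} (hp : 1 ≤ p)
    (h : γ < compExp p (wordDist S)) :
    γ < 1 ∧ ∃ C, 0 < C ∧ HasCompression p γ C (wordDist S) := by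
  rw [compExp_eq_sSup] at h
  obtain ⟨α, ⟨-, h1, C, hC, hα⟩, hlt⟩ :=
    exists_lt_of_lt_csSup (nonempty_compression hp wordDist_nonneg) h
  exact ⟨hlt.trans_le h1, C + 1, by positivity, hα.anti hC hlt.le⟩

theorem HasCompression.le_compExp (h : HasCompression p α C d) (hC : 0 < C) (h0 : 0 ≤ α)
    (h1 : α ≤ 1) : α ≤ compExp p d := by
  rw [compExp_eq_sSup]
  exact le_csSup (bddAbove_compression p d) ⟨h0, h1, C, hC, h⟩

end CompressionExponent

section BinaryFreeProduct

open Monoid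

universe u v

theorem wordDist_map {G K : Type*} [Group G] [Group K] {S : Set G} {T : Set K}
    (hS : Subgroup.closure S = ⊤) (hT : Subgroup.closure T = ⊤) (f : G →* K) (r : K →* G)
    (hrf : ∀ g, r (f g) = g) (hf : ∀ s ∈ S, f s ∈ T ∨ f s = 1) (hr : ∀ t ∈ T, r t ∈ S ∨ r t = 1)
    (x y : G) : wordDist T (f x) (f y) = wordDist S x y := by
  unfold wordDist
  rw [← map_inv, ← map_mul]
  refine congrArg _ (le_antisymm (wordNorm_map_le hS hT f hf _) ?_)
  simpa only [hrf] using wordNorm_map_le hT hS r hr (f (x⁻¹ * y))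

variable {G : Type u} {H : Type v} [Group G] [Group H] {S : Set G} {T : Set H}

/-- The generating set of `G ∗ H` given by generating sets of `G` and `H`. -/
def coprodGens (S : Set G) (T : Set H) : Set (Coprod G H) :=
  ((Coprod.inl : G →* Coprod G H) '' S) ∪ ((Coprod.inr : H →* Coprod G H) '' T)

theorem closure_coprodGens (hS : Subgroup.closure S = ⊤) (hT : Subgroup.closure T = ⊤) :
    Subgroup.closure (coprodGens S T) = ⊤ := by
  rw [coprodGens, Subgroup.closure_union, ← MonoidHom.map_closure, ← MonoidHom.map_closure, hS,
    hT, ← MonoidHom.range_eq_map, ← MonoidHom.range_eq_map, Coprod.range_inl_sup_range_inr]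

theorem wordDist_inl (hS : Subgroup.closure S = ⊤) (hT : Subgroup.closure T = ⊤) (x y : G) :
    wordDist (coprodGens S T) (Coprod.inl x) (Coprod.inl y) = wordDist S x y := by
  refine wordDist_map hS (closure_coprodGens hS hT) Coprod.inl Coprod.fst (by simp)
    (fun s hs => .inl (.inl ⟨s, hs, rfl⟩)) ?_ x y
  rintro _ (⟨s, hs, rfl⟩ | ⟨t, ht, rfl⟩)
  · exact .inl (by simpa using hs)
  · exact .inr (by simp)

theorem wordDist_inr (hS : Subgroup.closure S = ⊤) (hT : Subgroup.closure T = ⊤) (x y : H) :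
    wordDist (coprodGens S T) (Coprod.inr x) (Coprod.inr y) = wordDist T x y := by
  refine wordDist_map hT (closure_coprodGens hS hT) Coprod.inr Coprod.snd (by simp)
    (fun t ht => .inl (.inr ⟨t, ht, rfl⟩)) ?_ x y
  rintro _ (⟨s, hs, rfl⟩ | ⟨t, ht, rfl⟩)
  · exact .inr (by simp)
  · exact .inl (by simpa using ht)

/-- The two factors `G` and `H`, lifted to a common universe. -/
def Factor (G : Type u) (H : Type v) : Bool → Type max u v
  | true => ULift.{v} G
  | false => ULift.{u} H

instance : ∀ b, Group (Factor G H b)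
  | true => inferInstanceAs (Group (ULift G))
  | false => inferInstanceAs (Group (ULift H))

instance [Countable G] [Countable H] : ∀ b, Countable (Factor G H b)
  | true => inferInstanceAs (Countable (ULift G))
  | false => inferInstanceAs (Countable (ULift H))

/-- The factor with index `true` is `G`. -/
def factorLeft : G ≃* Factor G H true := MulEquiv.ulift.symm

/-- The factor with index `false` is `H`. -/
def factorRight : H ≃* Factor G H false := MulEquiv.ulift.symm

/-- The generating sets of the two factors. -/
def factorGens (S : Set G) (T : Set H) : ∀ b, Set (Factor G H b)
  | true => factorLeft '' S
  | false => factorRight '' T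

theorem closure_image_mulEquiv {K L : Type*} [Group K] [Group L] {S : Set K} (e : K ≃* L)
    (hS : Subgroup.closure S = ⊤) : Subgroup.closure (e '' S) = ⊤ := by
  have := MonoidHom.map_closure e.toMonoidHom S
  rw [hS, ← MonoidHom.range_eq_map, MonoidHom.range_eq_top.2 e.surjective] at this
  exact this.symm

theorem wordDist_image_mulEquiv {K L : Type*} [Group K] [Group L] {S : Set K} (e : K ≃* L)
    (hS : Subgroup.closure S = ⊤) (x y : L) :
    wordDist S (e.symm x) (e.symm y) = wordDist (e '' S) x y := by
  refine wordDist_map (closure_image_mulEquiv e hS) hS e.symm.toMonoidHom e.toMonoidHom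
    (by simp) ?_ (fun s hs => .inl ⟨s, hs, rfl⟩) x y
  rintro _ ⟨s, hs, rfl⟩
  exact .inl (by simpa using hs)

theorem closure_factorGens (hS : Subgroup.closure S = ⊤) (hT : Subgroup.closure T = ⊤) :
    ∀ b, Subgroup.closure (factorGens S T b) = ⊤
  | true => closure_image_mulEquiv factorLeft hS
  | false => closure_image_mulEquiv factorRight hT

/-- The binary free product maps to the free product of the family of its two factors. -/
def toCoprodI : Coprod G H →* CoprodI (Factor G H) :=
  Coprod.lift ((CoprodI.of (i := true)).comp (factorLeft (G := G) (H := H)).toMonoidHom)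
    ((CoprodI.of (i := false)).comp (factorRight (G := G) (H := H)).toMonoidHom)

/-- The inverse of `toCoprodI`. -/
def ofCoprodI : CoprodI (Factor G H) →* Coprod G H :=
  CoprodI.lift fun
    | true => Coprod.inl.comp (factorLeft (G := G) (H := H)).symm.toMonoidHom
    | false => Coprod.inr.comp (factorRight (G := G) (H := H)).symm.toMonoidHom

theorem ofCoprodI_comp_toCoprodI :
    (ofCoprodI.comp toCoprodI : Coprod G H →* Coprod G H) = MonoidHom.id _ := by
  refine Coprod.hom_ext ?_ ?_ <;> ext x <;> simp [ofCoprodI, toCoprodI]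

theorem wordDist_toCoprodI (hS : Subgroup.closure S = ⊤) (hT : Subgroup.closure T = ⊤)
    (x y : Coprod G H) :
    wordDist (freeProductGens (factorGens S T)) (toCoprodI x) (toCoprodI y) =
      wordDist (coprodGens S T) x y := by
  refine wordDist_map (closure_coprodGens hS hT)
    (closure_freeProductGens (closure_factorGens hS hT)) toCoprodI ofCoprodI
    (fun g => DFunLike.congr_fun ofCoprodI_comp_toCoprodI g) ?_ ?_ x y
  · rintro _ (⟨s, hs, rfl⟩ | ⟨t, ht, rfl⟩)
    · exact .inl (Set.mem_iUnion.2 ⟨true, _, ⟨s, hs, rfl⟩, by simp [toCoprodI]⟩)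
    · exact .inl (Set.mem_iUnion.2 ⟨false, _, ⟨t, ht, rfl⟩, by simp [toCoprodI]⟩)
  · rintro _ hx
    obtain ⟨b, _, hb, rfl⟩ := Set.mem_iUnion.1 hx
    cases b
    · obtain ⟨t, ht, rfl⟩ := hb
      exact .inl (.inr ⟨t, ht, by simp [ofCoprodI]⟩)
    · obtain ⟨s, hs, rfl⟩ := hb
      exact .inl (.inl ⟨s, hs, by simp [ofCoprodI]⟩)

theorem exists_hasCompression_coprod [Countable G] [Countable H] {p γ C : ℝ}
    (hS : Subgroup.closure S = ⊤) (hT : Subgroup.closure T = ⊤) (hp : 1 ≤ p) (hγ : 0 ≤ γ)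
    (hγ1 : γ < 1) (hC : 0 < C) (hG : HasCompression p γ C (wordDist S))
    (hH : HasCompression p γ C (wordDist T)) :
    ∃ K, 0 < K ∧ HasCompression p γ K (wordDist (coprodGens S T)) := by
  have hF : ∀ b, HasCompression p γ C (wordDist (factorGens S T b))
    | true => hG.comp factorLeft.symm (wordDist_image_mulEquiv factorLeft hS)
    | false => hH.comp factorRight.symm (wordDist_image_mulEquiv factorRight hT)
  choose φ hφ using hF
  obtain ⟨F, K, hK, hFK⟩ := exists_embedding_coprodI (closure_factorGens hS hT) hp hγ hγ1 hC hφ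
  exact ⟨K, hK, HasCompression.comp ⟨F, hFK⟩ toCoprodI (wordDist_toCoprodI hS hT)⟩

theorem countable_of_closure_eq_top {K : Type*} [Group K] {S : Set K} (hfin : S.Finite)
    (hS : Subgroup.closure S = ⊤) : Countable K := by
  have : Countable ↥(S ∪ S⁻¹) := (hfin.union hfin.inv).countable
  refine Function.Surjective.countable
    (f := fun l : List ↥(S ∪ S⁻¹) => (l.map Subtype.val).prod) fun g => ?_
  obtain ⟨l, hl, -, rfl⟩ := exists_list_prod_eq hS g
  lift l to List ↥(S ∪ S⁻¹) using hl
  exact ⟨l, rfl⟩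

theorem compExp_coprodGens {p : ℝ} (hSfin : S.Finite) (hTfin : T.Finite)
    (hS : Subgroup.closure S = ⊤) (hT : Subgroup.closure T = ⊤) (hp : 1 ≤ p) :
    compExp p (wordDist (coprodGens S T)) =
      min (compExp p (wordDist S)) (compExp p (wordDist T)) := by
  have : Countable G := countable_of_closure_eq_top hSfin hS
  have : Countable H := countable_of_closure_eq_top hTfin hT
  refine le_antisymm (le_min ?_ ?_) (le_of_forall_lt_imp_le_of_dense fun γ hγ => ?_)
  · exact compExp_le_of_isometry hp wordDist_nonneg Coprod.inl (wordDist_inl hS hT)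
  · exact compExp_le_of_isometry hp wordDist_nonneg Coprod.inr (wordDist_inr hS hT)
  · rcases lt_or_ge γ 0 with h0 | h0
    · exact h0.le.trans (compExp_nonneg _ _)
    obtain ⟨hγ1, C, hC, hG⟩ := exists_hasCompression_of_lt hp (hγ.trans_le (min_le_left _ _))
    obtain ⟨-, C', hC', hH⟩ := exists_hasCompression_of_lt hp (hγ.trans_le (min_le_right _ _))
    obtain ⟨K, hK, hGH⟩ := exists_hasCompression_coprod hS hT hp h0 hγ1
      (lt_max_of_lt_left hC) (hG.mono_const wordDist_nonneg hC (le_max_left C C'))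
      (hH.mono_const wordDist_nonneg hC' (le_max_right C C'))
    exact hGH.le_compExp hK h0 hγ1.le

end BinaryFreeProduct

/-- Free-product case of the main theorem (via the tree-graded embedding theorem applied
to the Cayley graph of `G ∗ H`, which is tree-graded with pieces the cosets of `G` and
`H`): if the finitely generated groups `G` and `H` admit `1`-Lipschitz coarse embeddings
into `ℓ^p` with a common concave lower bound `ρ'` tending to infinity, then for all
`p ≥ 1`, `α_p^*(G ∗ H) = min (α_p^*(G), α_p^*(H))`. -/
theorem stmt11 {G H : Type*} [Group G] [Group H]
    (S : Set G) (T : Set H) (hSfin : S.Finite) (hTfin : T.Finite)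
    (hSgen : Subgroup.closure S = ⊤) (hTgen : Subgroup.closure T = ⊤)
    (ρ' : ℕ → ℝ) (hρ0 : ∀ n, 0 ≤ ρ' n) (hρmono : Monotone ρ')
    (hρconc : ∀ m n : ℕ, m ≤ n → ρ' (n + m) - ρ' n ≤ ρ' n - ρ' (n - m))
    (hρtop : Filter.Tendsto ρ' Filter.atTop Filter.atTop)
    (hGemb : ∀ p : ℝ, 1 ≤ p →
      ∃ φ : G → lp (fun _ : ℕ => ℝ) (ENNReal.ofReal p),
        ∀ x y : G, ρ' (wordNorm S (x⁻¹ * y)) ≤ ‖φ x - φ y‖ ∧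
          ‖φ x - φ y‖ ≤ wordDist S x y)
    (hHemb : ∀ p : ℝ, 1 ≤ p →
      ∃ φ : H → lp (fun _ : ℕ => ℝ) (ENNReal.ofReal p),
        ∀ x y : H, ρ' (wordNorm T (x⁻¹ * y)) ≤ ‖φ x - φ y‖ ∧
          ‖φ x - φ y‖ ≤ wordDist T x y) :
    ∀ p : ℝ, 1 ≤ p →
      compExp p (wordDist (((Monoid.Coprod.inl : G →* Monoid.Coprod G H) '' S) ∪
          ((Monoid.Coprod.inr : H →* Monoid.Coprod G H) '' T)))
        = min (compExp p (wordDist S)) (compExp p (wordDist T)) := by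
  exact fun p hp => compExp_coprodGens hSfin hTfin hSgen hTgen hp
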